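/- arXiv:2104.04853 — 2 statements merged into one kernel-verified Lean document; each statement's English description precedes it below -/
import Mathlib

section
/- (Lemma 1 of the paper, for deterministic policies.) In the finite adaptive-optimization model described in the context, suppose f is adaptive submodular with respect to p, and let pi_a, pi_b, pi_c be deterministic policies with range(pi_b) inter range(pi_c) = empty. Then f_avg(pi_a @ pi_b) + f_avg(pi_a @ pi_c) >= f_avg(pi_a); explicitly, sum over phi of p(phi)*f(E(pi_a,phi) union E(pi_b,phi), phi) + sum over phi of p(phi)*f(E(pi_a,phi) union E(pi_c,phi), phi) >= sum over phi of p(phi)*f(E(pi_a,phi), phi). -/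
open Finset

variable {E O : Type*}

/-- The probability of the partial realization `(S, ψ)`: the total prior mass of
realizations agreeing with `ψ` on `S`. -/
def prPartial [Fintype E] [DecidableEq E] [Fintype O] [DecidableEq O]
    (p : (E → O) → ℝ) (S : Finset E) (ψ : E → O) : ℝ :=
  ∑ φ ∈ Finset.univ.filter (fun φ : E → O => ∀ e ∈ S, φ e = ψ e), p φ

/-- The conditional expected marginal utility `Δ(e | S, ψ)` of item `e` given
the partial realization `(S, ψ)`. -/
noncomputable def condMarginal [Fintype E] [DecidableEq E] [Fintype O] [DecidableEq O]
    (p : (E → O) → ℝ) (f : Finset E → (E → O) → ℝ)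
    (e : E) (S : Finset E) (ψ : E → O) : ℝ :=
  (∑ φ ∈ Finset.univ.filter (fun φ : E → O => ∀ a ∈ S, φ a = ψ a),
      p φ * (f (insert e S) φ - f S φ)) / prPartial p S ψ

/-- `f` is adaptive submodular with respect to the prior `p`. -/
def AdaptiveSubmodular [Fintype E] [DecidableEq E] [Fintype O] [DecidableEq O]
    (p : (E → O) → ℝ) (f : Finset E → (E → O) → ℝ) : Prop :=
  ∀ (S S' : Finset E) (ψ ψ' : E → O), S ⊆ S' → (∀ e ∈ S, ψ' e = ψ e) →
    0 < prPartial p S' ψ' → ∀ e ∉ S',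
      condMarginal p f e S ψ ≥ condMarginal p f e S' ψ'

/-- A deterministic adaptive policy: given the set of already-selected items and a
realization (only the states of the selected items may be consulted), it either
selects a fresh item or stops. -/
structure Policy (E O : Type*) [DecidableEq E] where
  act : Finset E → (E → O) → Option E
  act_congr : ∀ (S : Finset E) (ψ ψ' : E → O), (∀ e ∈ S, ψ e = ψ' e) → act S ψ = act S ψ'
  act_fresh : ∀ (S : Finset E) (ψ : E → O) (e : E), act S ψ = some e → e ∉ S

/-- Run the policy for at most `n` more steps starting from the current set `S`. -/
def selectAux [DecidableEq E] (π : Policy E O) (φ : E → O) : ℕ → Finset E → Finset E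
  | 0, S => S
  | n + 1, S =>
    match π.act S φ with
    | none => S
    | some e => selectAux π φ n (insert e S)

/-- The set of items selected by policy `π` under realization `φ`. -/
def selected [Fintype E] [DecidableEq E] (π : Policy E O) (φ : E → O) : Finset E :=
  selectAux π φ (Fintype.card E) ∅

/-- The range of a policy: all items it selects under some realization of positive
prior probability. -/
def polRange [Fintype E] [DecidableEq E] (p : (E → O) → ℝ) (π : Policy E O) : Set E :=
  { e | ∃ φ : E → O, 0 < p φ ∧ e ∈ selected π φ }

/-- A realization-dependent set `T` is observable when the states of the items of `T φ`
determine `T φ`. -/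
def Observable (T : (E → O) → Finset E) : Prop :=
  ∀ φ ψ : E → O, (∀ e ∈ T φ, ψ e = φ e) → T ψ = T φ

theorem Observable.union [DecidableEq E] {T U : (E → O) → Finset E}
    (hT : Observable T) (hU : Observable U) : Observable (fun φ => T φ ∪ U φ) := by
  intro φ ψ h
  have h1 := hT φ ψ fun e he => h e (mem_union_left _ he)
  have h2 := hU φ ψ fun e he => h e (mem_union_right _ he)
  simp only [h1, h2]

theorem selectAux_succ [DecidableEq E] (π : Policy E O) (φ : E → O) (n : ℕ) (S : Finset E) :
    selectAux π φ (n + 1) S =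
      selectAux π φ n S ∪ (π.act (selectAux π φ n S) φ).toFinset := by
  induction n generalizing S with
  | zero =>
    simp only [selectAux]
    cases π.act S φ <;> simp
  | succ n ih =>
    rw [selectAux]
    cases h : π.act S φ with
    | none => simp [selectAux, h]
    | some e =>
      simp only [ih (insert e S)]
      simp [selectAux, h]

theorem selectAux_mono [DecidableEq E] (π : Policy E O) (φ : E → O) (S : Finset E) :
    Monotone fun n => selectAux π φ n S :=
  monotone_nat_of_le_succ fun n => by
    rw [selectAux_succ]
    exact subset_union_left

theorem observable_selectAux [DecidableEq E] (π : Policy E O) (n : ℕ) :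
    Observable fun φ => selectAux π φ n ∅ := by
  induction n with
  | zero => intro φ ψ _; rfl
  | succ n ih =>
    intro φ ψ h
    simp only [selectAux_succ] at h ⊢
    have h1 : ∀ e ∈ selectAux π φ n ∅, ψ e = φ e := fun e he => h e (mem_union_left _ he)
    have h2 := ih φ ψ h1
    simp only at h2
    rw [h2, π.act_congr _ ψ φ h1]

section Averaging

variable [Fintype E] [DecidableEq E] [Fintype O] [DecidableEq O]

theorem prPartial_pos {p : (E → O) → ℝ} (hp : ∀ φ, 0 ≤ p φ) {φ : E → O} (hφ : 0 < p φ)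
    (S : Finset E) : 0 < prPartial p S φ :=
  hφ.trans_le <| single_le_sum (f := p) (fun ψ _ => hp ψ) (by simp)

theorem prPartial_congr (p : (E → O) → ℝ) {S : Finset E} {φ ψ : E → O}
    (h : ∀ e ∈ S, ψ e = φ e) : prPartial p S ψ = prPartial p S φ := by
  unfold prPartial
  congr 1
  ext χ
  simp only [mem_filter, mem_univ, true_and]
  exact forall₂_congr fun e he => by rw [h e he]

/-- The tower property for conditioning on an observable set. -/
theorem Observable.sum_eq_sum_average {p : (E → O) → ℝ} (hp : ∀ φ, 0 ≤ p φ)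
    {T : (E → O) → Finset E} (hT : Observable T) (h : (E → O) → ℝ) :
    ∑ φ, p φ * h φ =
      ∑ φ, p φ * ((∑ ψ ∈ univ.filter (fun ψ : E → O => ∀ a ∈ T φ, ψ a = φ a), p ψ * h ψ) /
        prPartial p (T φ) φ) := by
  have key : ∀ φ ψ : E → O,
      (if ∀ a ∈ T φ, ψ a = φ a then p φ * (p ψ * h ψ / prPartial p (T φ) φ) else 0) =
      (if ∀ a ∈ T ψ, φ a = ψ a then p ψ * h ψ / prPartial p (T ψ) ψ * p φ else 0) := by
    intro φ ψ
    by_cases h1 : ∀ a ∈ T φ, ψ a = φ a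
    · have h2 := hT φ ψ h1
      have h3 : ∀ a ∈ T ψ, φ a = ψ a := fun a ha => (h1 a (h2 ▸ ha)).symm
      rw [if_pos h1, if_pos h3, h2, prPartial_congr p h1, mul_comm]
    · have h3 : ¬ ∀ a ∈ T ψ, φ a = ψ a := fun h3 =>
        h1 fun a ha => (h3 a (hT ψ φ h3 ▸ ha)).symm
      rw [if_neg h1, if_neg h3]
  simp only [sum_filter, sum_div, mul_sum, ite_div, mul_ite, zero_div, mul_zero, key]
  rw [sum_comm]
  refine sum_congr rfl fun ψ _ => ?_
  rw [← sum_filter, ← mul_sum]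
  change p ψ * h ψ = p ψ * h ψ / prPartial p (T ψ) ψ * prPartial p (T ψ) ψ
  rcases (hp ψ).eq_or_lt with h0 | h0
  · simp [← h0]
  · rw [div_mul_cancel₀ _ (prPartial_pos hp h0 _).ne']

/-- Diminishing expected returns of an adaptively chosen item. -/
theorem AdaptiveSubmodular.sum_marginal_le {p : (E → O) → ℝ}
    {f : Finset E → (E → O) → ℝ} (hAS : AdaptiveSubmodular p f) (hp : ∀ φ, 0 ≤ p φ)
    {T U : (E → O) → Finset E} (hT : Observable T) (hU : Observable U)
    (hTU : ∀ φ, T φ ⊆ U φ) (g : (E → O) → Option E)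
    (hg : ∀ φ ψ : E → O, (∀ e ∈ T φ, ψ e = φ e) → g ψ = g φ)
    (hfresh : ∀ φ, 0 < p φ → ∀ e, g φ = some e → e ∈ U φ → e ∈ T φ) :
    ∑ φ, p φ * (f (U φ ∪ (g φ).toFinset) φ - f (U φ) φ) ≤
      ∑ φ, p φ * (f (T φ ∪ (g φ).toFinset) φ - f (T φ) φ) := by
  rw [hU.sum_eq_sum_average hp,
    hT.sum_eq_sum_average hp fun φ => f (T φ ∪ (g φ).toFinset) φ - f (T φ) φ]
  have average_eq : ∀ (V : (E → O) → Finset E), Observable V → (∀ φ, T φ ⊆ V φ) → ∀ φ : E → O,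
      ∑ ψ ∈ univ.filter (fun ψ : E → O => ∀ a ∈ V φ, ψ a = φ a),
        p ψ * (f (V ψ ∪ (g ψ).toFinset) ψ - f (V ψ) ψ) =
      ∑ ψ ∈ univ.filter (fun ψ : E → O => ∀ a ∈ V φ, ψ a = φ a),
        p ψ * (f (V φ ∪ (g φ).toFinset) ψ - f (V φ) ψ) := by
    intro V hV hTV φ
    refine sum_congr rfl fun ψ hψ => ?_
    have h1 := (mem_filter.mp hψ).2
    rw [hV φ ψ h1, hg φ ψ fun e he => h1 e (hTV φ he)]
  refine sum_le_sum fun φ _ => ?_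
  rw [average_eq U hU hTU, average_eq T hT fun _ => Subset.rfl]
  rcases (hp φ).eq_or_lt with h0 | h0
  · simp [← h0]
  refine mul_le_mul_of_nonneg_left ?_ (hp φ)
  cases hgφ : g φ with
  | none => simp
  | some e =>
    have union_eq : ∀ S : Finset E, S ∪ (some e).toFinset = insert e S := fun S => by simp
    simp only [union_eq]
    by_cases he : e ∈ U φ
    · simp [insert_eq_of_mem he, insert_eq_of_mem (hfresh φ h0 e hgφ he)]
    · exact hAS (T φ) (U φ) φ φ (hTU φ) (fun _ _ => rfl) (prPartial_pos hp h0 _) e he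

/-- The expected gain of a policy does not increase when it is run after a larger observable
set that contains no item of its range outside the smaller one. -/
theorem AdaptiveSubmodular.sum_selectAux_le {p : (E → O) → ℝ}
    {f : Finset E → (E → O) → ℝ} (hAS : AdaptiveSubmodular p f) (hp : ∀ φ, 0 ≤ p φ)
    {A C : (E → O) → Finset E} (hA : Observable A) (hC : Observable C) (π : Policy E O)
    (hdisj : ∀ φ, 0 < p φ → Disjoint (selected π φ) (C φ))
    {n : ℕ} (hn : n ≤ Fintype.card E) :
    ∑ φ, p φ * (f (A φ ∪ C φ ∪ selectAux π φ n ∅) φ - f (A φ ∪ C φ) φ) ≤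
      ∑ φ, p φ * (f (A φ ∪ selectAux π φ n ∅) φ - f (A φ) φ) := by
  induction n with
  | zero => simp [selectAux]
  | succ n ih =>
    have step := hAS.sum_marginal_le hp
      (hA.union (observable_selectAux π n)) ((hA.union hC).union (observable_selectAux π n))
      (fun φ => union_subset_union_left subset_union_left)
      (fun φ => π.act (selectAux π φ n ∅) φ)
      (fun φ ψ h => by
        have h1 : ∀ e ∈ selectAux π φ n ∅, ψ e = φ e := fun e he => h e (mem_union_right _ he)
        have h2 : selectAux π ψ n ∅ = selectAux π φ n ∅ := observable_selectAux π n φ ψ h1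
        simp only [h2]
        exact π.act_congr _ ψ φ h1)
      (fun φ h0 e he heU => by
        have h1 : e ∈ selected π φ := by
          refine selectAux_mono π φ ∅ hn ?_
          simp only [selectAux_succ]
          exact mem_union_right _ (by simp [he])
        have h2 := disjoint_left.mp (hdisj φ h0) h1
        simp only [mem_union] at heU ⊢
        tauto)
    have total := add_le_add (ih (Nat.le_of_succ_le hn)) step
    simp only [← sum_add_distrib, ← mul_add, sub_add_sub_cancel'] at total
    simp only [selectAux_succ, ← union_assoc]
    exact total

end Averaging

theorem adaptive_submodular_concat_lower_bound
    [Fintype E] [DecidableEq E] [Fintype O] [DecidableEq O]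
    (p : (E → O) → ℝ) (f : Finset E → (E → O) → ℝ)
    (hp : ∀ φ, 0 ≤ p φ) (hp1 : ∑ φ : E → O, p φ = 1)
    (hf : ∀ (S : Finset E) (φ : E → O), 0 ≤ f S φ)
    (hAS : AdaptiveSubmodular p f)
    (πa πb πc : Policy E O)
    (hdisj : polRange p πb ∩ polRange p πc = ∅) :
    (∑ φ : E → O, p φ * f (selected πa φ ∪ selected πb φ) φ) +
      (∑ φ : E → O, p φ * f (selected πa φ ∪ selected πc φ) φ) ≥
      ∑ φ : E → O, p φ * f (selected πa φ) φ := by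
  have hmain := hAS.sum_selectAux_le hp (A := selected πa) (C := selected πc)
    (observable_selectAux πa _) (observable_selectAux πc _) πb
    (fun φ h0 => disjoint_left.mpr fun e hb hc =>
      (Set.eq_empty_iff_forall_notMem.mp hdisj e) ⟨⟨φ, h0, hb⟩, ⟨φ, h0, hc⟩⟩) le_rfl
  have hnonneg : 0 ≤ ∑ φ, p φ * f (selected πa φ ∪ selected πc φ ∪ selected πb φ) φ :=
    sum_nonneg fun φ _ => mul_nonneg (hp φ) (hf _ φ)
  simp only [mul_sub, sum_sub_distrib] at hmain
  change _ - _ ≤ ∑ φ, p φ * f (selected πa φ ∪ selected πb φ) φ - _ at hmain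
  change ∑ φ, p φ * f (selected πa φ ∪ selected πc φ ∪ selected πb φ) φ - _ ≤ _ at hmain
  linarith
end

section
/- (Deterministic specialization of the paper's Theorem 1.) In the deterministic knapsack setting of the context, let S be a uniformly random subset of E (each item included independently with probability 1/2), so Exp_S[h(S)] = 2^(-|E|) * sum over all subsets S of E of h(S). Then (1/5) * (max over e in E of g({e})) + (4/5) * Exp_S[ g(DG(S)) ] >= (1/10) * (max of g(T) over all finsets T with c(T) <= b). -/
open Finset

variable {E : Type*}

/-- Pick, from a nonempty finset `F`, the element maximizing the score `r`,
breaking ties by taking the least such element in the fixed linear order. -/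
noncomputable def pick [LinearOrder E] (F : Finset E) (r : E → ℝ) (h : F.Nonempty) : E :=
  (F.filter fun e => ∀ e' ∈ F, r e' ≤ r e).min' (by
    obtain ⟨a, ha, hm⟩ := F.exists_max_image r h
    exact ⟨a, Finset.mem_filter.mpr ⟨ha, hm⟩⟩)

/-- One pass of density greedy with fuel `n`: `V` is the set selected so far and
`C` the remaining budget. -/
noncomputable def densityGreedyAux [DecidableEq E] [LinearOrder E]
    (g : Finset E → ℝ) (c : E → ℝ) (S : Finset E) :
    ℕ → Finset E → ℝ → Finset E
  | 0, V, _ => V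
  | n + 1, V, C =>
    let F := S.filter fun e => e ∉ V ∧ c e ≤ C ∧ 0 < g (insert e V) - g V
    if h : F.Nonempty then
      let e := pick F (fun e => (g (insert e V) - g V) / c e) h
      densityGreedyAux g c S n (insert e V) (C - c e)
    else V

/-- The output of density greedy run on the available item set `S` with budget `b`. -/
noncomputable def densityGreedy [Fintype E] [DecidableEq E] [LinearOrder E]
    (g : Finset E → ℝ) (c : E → ℝ) (b : ℝ) (S : Finset E) : Finset E :=
  densityGreedyAux g c S (Fintype.card E) ∅ b

section Submodular

variable [DecidableEq E] {g : Finset E → ℝ}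

/-- Submodular functions have diminishing marginal gains. -/
theorem marginal_insert_le
    (hsub : ∀ S T : Finset E, g (S ∪ T) + g (S ∩ T) ≤ g S + g T)
    {a e : E} (hae : a ≠ e) (V : Finset E) :
    g (insert a (insert e V)) - g (insert e V) ≤ g (insert a V) - g V := by
  by_cases haV : a ∈ V
  · rw [insert_eq_of_mem haV, insert_eq_of_mem (mem_insert_of_mem haV)]
    simp
  · have h := hsub (insert a V) (insert e V)
    have hu : insert a V ∪ insert e V = insert a (insert e V) := by
      ext x; simp only [mem_union, mem_insert]; tauto
    have hi : insert a V ∩ insert e V = V := by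
      ext x
      simp only [mem_inter, mem_insert]
      grind
    rw [hu, hi] at h
    linarith

/-- The gain of adding a set is at most the sum of the marginal gains of its elements. -/
theorem union_le_add_sum_marginal
    (hsub : ∀ S T : Finset E, g (S ∪ T) + g (S ∩ T) ≤ g S + g T)
    (X V : Finset E) :
    g (X ∪ V) ≤ g V + ∑ x ∈ X, (g (insert x V) - g V) := by
  induction X using Finset.induction_on with
  | empty => simp
  | insert x X hx ih =>
    rw [sum_insert hx]
    by_cases hxV : x ∈ V
    · have hu : insert x X ∪ V = X ∪ V := by
        rw [insert_union, insert_eq_of_mem (mem_union_right _ hxV)]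
      rw [hu, insert_eq_of_mem hxV]
      linarith
    · have h := hsub (X ∪ V) (insert x V)
      have hu : (X ∪ V) ∪ insert x V = insert x X ∪ V := by
        ext y; simp only [mem_union, mem_insert]; tauto
      have hi : (X ∪ V) ∩ insert x V = V := by
        ext y
        simp only [mem_inter, mem_union, mem_insert]
        grind
      rw [hu, hi] at h
      linarith

/-- A marginal gain is at most the value of the singleton. -/
theorem marginal_le_singleton (hg : ∀ S : Finset E, 0 ≤ g S)
    (hsub : ∀ S T : Finset E, g (S ∪ T) + g (S ∩ T) ≤ g S + g T)
    (a : E) (V : Finset E) : g (insert a V) - g V ≤ g {a} := by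
  have h := hsub {a} V
  rw [singleton_union] at h
  linarith [hg ({a} ∩ V)]

/-- If every element of `U` lies in between `q` and `p` of the sets `R i ⊆ U`, then the sum of a
nonnegative submodular function over these sets is bounded below by the values at `∅` and `U`. -/
theorem le_sum_of_card_mem_le {ι : Type*} {h : Finset E → ℝ}
    (hh : ∀ S : Finset E, 0 ≤ h S)
    (hsub : ∀ S T : Finset E, h (S ∪ T) + h (S ∩ T) ≤ h S + h T)
    (I : Finset ι) (p : ℝ) (U : Finset E) (R : ι → Finset E) (q : ℝ) (hqp : q ≤ p)
    (hRU : ∀ i ∈ I, R i ⊆ U)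
    (hq : ∀ e ∈ U, q ≤ (#{i ∈ I | e ∈ R i} : ℝ))
    (hp : ∀ e ∈ U, (#{i ∈ I | e ∈ R i} : ℝ) ≤ p) :
    (#I - p) * h ∅ + q * h U ≤ ∑ i ∈ I, h (R i) := by
  induction hn : #U generalizing U R q with
  | zero =>
    obtain rfl := card_eq_zero.mp hn
    have hR : ∑ i ∈ I, h (R i) = ∑ i ∈ I, h ∅ :=
      sum_congr rfl fun i hi => by rw [subset_empty.mp (hRU i hi)]
    rw [hR, sum_const, nsmul_eq_mul]
    nlinarith [hh ∅]
  | succ n ih =>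
    have hU : U.Nonempty := card_pos.mp (by omega)
    obtain ⟨e, heU, hmin⟩ := U.exists_min_image (fun e => #{i ∈ I | e ∈ R i}) hU
    set k : ℝ := (#{i ∈ I | e ∈ R i} : ℝ) with hk
    have hcard : ∀ x ∈ U.erase e,
        #{i ∈ I | x ∈ (R i).erase e} = #{i ∈ I | x ∈ R i} := by
      intro x hx
      simp [ne_of_mem_erase hx]
    have hind := ih (U.erase e) (fun i => (R i).erase e) k (hp e heU)
      (fun i hi => erase_subset_erase _ (hRU i hi))
      (fun x hx => by
        rw [hcard x hx]
        exact Nat.cast_le.mpr (hmin x (mem_of_mem_erase hx)))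
      (fun x hx => by
        rw [hcard x hx]
        exact hp x (mem_of_mem_erase hx))
      (by rw [card_erase_of_mem heU, hn]; rfl)
    have hpt : ∀ i ∈ I, h ((R i).erase e) +
        (if e ∈ R i then h U - h (U.erase e) else 0) ≤ h (R i) := by
      intro i hi
      split_ifs with hei
      · have h1 := hsub (R i) (U.erase e)
        have hu : R i ∪ U.erase e = U := by
          have := hRU i hi
          ext x
          simp only [mem_union, mem_erase]
          grind
        have h_inter : R i ∩ U.erase e = (R i).erase e := by
          have := hRU i hi
          ext x
          simp only [mem_inter, mem_erase]
          grind
        rw [hu, h_inter] at h1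
        linarith
      · rw [erase_eq_of_notMem hei, add_zero]
    have hs := sum_le_sum hpt
    rw [sum_add_distrib, ← sum_filter, sum_const, nsmul_eq_mul, ← hk] at hs
    nlinarith [hh U, hq e heU]

end Submodular

section Pick

variable [LinearOrder E]

theorem pick_mem_filter (F : Finset E) (r : E → ℝ) (h : F.Nonempty) :
    pick F r h ∈ F.filter fun e => ∀ e' ∈ F, r e' ≤ r e :=
  min'_mem _ _

theorem pick_mem (F : Finset E) (r : E → ℝ) (h : F.Nonempty) : pick F r h ∈ F :=
  (mem_filter.mp (pick_mem_filter F r h)).1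

theorem le_pick (F : Finset E) (r : E → ℝ) (h : F.Nonempty) {a : E} (ha : a ∈ F) :
    r a ≤ r (pick F r h) :=
  (mem_filter.mp (pick_mem_filter F r h)).2 a ha

/-- Removing candidates other than the picked one does not change the pick. -/
theorem pick_eq_of_subset {F F' : Finset E} (r : E → ℝ) (h : F.Nonempty) (h' : F'.Nonempty)
    (hs : F' ⊆ F) (hm : pick F r h ∈ F') : pick F' r h' = pick F r h := by
  apply le_antisymm
  · exact min'_le _ _ (mem_filter.mpr ⟨hm, fun a ha => le_pick F r h (hs ha)⟩)
  · exact min'_le _ _ (mem_filter.mpr ⟨hs (pick_mem F' r h'),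
      fun a ha => (le_pick F r h ha).trans (le_pick F' r h' hm)⟩)

end Pick

section Greedy

variable [DecidableEq E]

/-- The items of `S` that density greedy may add to `V` with remaining budget `C`. -/
noncomputable def greedyCandidates (g : Finset E → ℝ) (c : E → ℝ) (S V : Finset E) (C : ℝ) :
    Finset E :=
  S.filter fun e => e ∉ V ∧ c e ≤ C ∧ 0 < g (insert e V) - g V

theorem mem_greedyCandidates {g : Finset E → ℝ} {c : E → ℝ} {S V : Finset E} {C : ℝ} {e : E} :
    e ∈ greedyCandidates g c S V C ↔
      e ∈ S ∧ e ∉ V ∧ c e ≤ C ∧ 0 < g (insert e V) - g V :=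
  mem_filter

variable [LinearOrder E]

theorem densityGreedyAux_succ (g : Finset E → ℝ) (c : E → ℝ) (S : Finset E) (n : ℕ)
    (V : Finset E) (C : ℝ) (h : (greedyCandidates g c S V C).Nonempty) :
    densityGreedyAux g c S (n + 1) V C =
      densityGreedyAux g c S n
        (insert (pick (greedyCandidates g c S V C) (fun e => (g (insert e V) - g V) / c e) h) V)
        (C - c (pick (greedyCandidates g c S V C)
          (fun e => (g (insert e V) - g V) / c e) h)) := by
  rw [densityGreedyAux]
  exact dif_pos h

theorem densityGreedyAux_succ_of_not_nonempty (g : Finset E → ℝ) (c : E → ℝ) (S : Finset E)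
    (n : ℕ) (V : Finset E) (C : ℝ) (h : ¬ (greedyCandidates g c S V C).Nonempty) :
    densityGreedyAux g c S (n + 1) V C = V := by
  rw [densityGreedyAux]
  exact dif_neg h

theorem le_densityGreedyAux (g : Finset E → ℝ) (c : E → ℝ) (S : Finset E) (n : ℕ)
    (V : Finset E) (C : ℝ) : g V ≤ g (densityGreedyAux g c S n V C) := by
  induction n generalizing V C with
  | zero => exact le_rfl
  | succ n ih =>
    by_cases h : (greedyCandidates g c S V C).Nonempty
    · rw [densityGreedyAux_succ g c S n V C h]
      refine le_trans ?_ (ih _ _)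
      have := (mem_greedyCandidates.mp (pick_mem _ (fun e => (g (insert e V) - g V) / c e) h)).2.2.2
      linarith
    · rw [densityGreedyAux_succ_of_not_nonempty g c S n V C h]

/-- Items already selected play no role in the remaining run. -/
theorem densityGreedyAux_insert_of_mem (g : Finset E → ℝ) (c : E → ℝ) (S : Finset E) (n : ℕ)
    {V : Finset E} {e : E} (he : e ∈ V) (C : ℝ) :
    densityGreedyAux g c (insert e S) n V C = densityGreedyAux g c S n V C := by
  induction n generalizing V C with
  | zero => rfl
  | succ n ih =>
    have hF : greedyCandidates g c (insert e S) V C = greedyCandidates g c S V C := by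
      ext x
      simp only [mem_greedyCandidates, mem_insert]
      grind
    by_cases h : (greedyCandidates g c S V C).Nonempty
    · rw [densityGreedyAux_succ g c S n V C h,
        densityGreedyAux_succ g c (insert e S) n V C (hF ▸ h)]
      simp only [hF]
      exact ih (mem_insert_of_mem he) _
    · rw [densityGreedyAux_succ_of_not_nonempty g c S n V C h,
        densityGreedyAux_succ_of_not_nonempty g c (insert e S) n V C (hF ▸ h)]

/-- If the best candidate `e` among the undecided items `A` is available, greedy takes it. -/
theorem densityGreedyAux_insert_pick (g : Finset E → ℝ) (c : E → ℝ) {A S : Finset E} (n : ℕ)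
    (V : Finset E) (C : ℝ) (h : (greedyCandidates g c A V C).Nonempty) {e : E}
    (he : pick (greedyCandidates g c A V C) (fun e => (g (insert e V) - g V) / c e) h = e)
    (hS : S ⊆ A) :
    densityGreedyAux g c (insert e S) (n + 1) V C =
      densityGreedyAux g c S n (insert e V) (C - c e) := by
  have heA := mem_greedyCandidates.mp (he ▸ pick_mem _ _ h)
  have hsub : greedyCandidates g c (insert e S) V C ⊆ greedyCandidates g c A V C :=
    filter_subset_filter _ (insert_subset heA.1 hS)
  have hmem : e ∈ greedyCandidates g c (insert e S) V C :=
    mem_greedyCandidates.mpr ⟨mem_insert_self _ _, heA.2⟩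
  rw [densityGreedyAux_succ g c (insert e S) n V C ⟨e, hmem⟩,
    pick_eq_of_subset _ h ⟨e, hmem⟩ hsub (by rwa [he]), he,
    densityGreedyAux_insert_of_mem g c S n (mem_insert_self e V)]

/-- Stopping density greedy as soon as an undecided item of `O` no longer fits. From a state with
selection `V` and undecided items `A`, the stopped outputs `T S` over all `S ⊆ A` satisfy an
averaged upper bound on `g (O ∪ T S)`. The threshold `l` bounds the densities of undecided items
and `Q` the marginal gains of the rejected items of `O`. -/
theorem exists_stopped_greedy {g : Finset E → ℝ} {c : E → ℝ} {b M : ℝ} {O : Finset E}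
    (hg : ∀ S : Finset E, 0 ≤ g S)
    (hsub : ∀ S T : Finset E, g (S ∪ T) + g (S ∩ T) ≤ g S + g T)
    (hc : ∀ e : E, 0 < c e) (hM : ∀ e, g {e} ≤ M) (hM0 : 0 ≤ M) (hO : ∑ e ∈ O, c e ≤ b)
    (k n : ℕ) (V A : Finset E) (l Q : ℝ) (hk : #A = k) (hn : k ≤ n) (hl : 0 ≤ l)
    (hV : (∑ e ∈ V, c e) * l ≤ g V)
    (hA : ∀ a ∈ A, (c a ≤ b - ∑ e ∈ V, c e ∨ a ∈ O) → g (insert a V) - g V ≤ l * c a)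
    (hQ : ∑ o ∈ O \ A, (g (insert o V) - g V) ≤ Q) :
    ∃ T : Finset E → Finset E,
      (∀ S ∈ A.powerset, T S ⊆ V ∪ S) ∧
      (∀ S ∈ A.powerset, g (T S) ≤ g (densityGreedyAux g c S n V (b - ∑ e ∈ V, c e))) ∧
      ∑ S ∈ A.powerset, g (O ∪ T S) ≤
        ∑ S ∈ A.powerset, (3 * g (T S) + M - g V + Q) := by
  induction k generalizing n V A l Q with
  | zero =>
    obtain rfl := card_eq_zero.mp hk
    refine ⟨fun _ => V, fun S _ => subset_union_left,
      fun S _ => le_densityGreedyAux g c S n V _, sum_le_sum fun S _ => ?_⟩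
    have h := union_le_add_sum_marginal hsub O V
    rw [sdiff_empty] at hQ
    linarith [hg V]
  | succ k ih =>
    have hsplit : ∑ o ∈ O \ A, (g (insert o V) - g V) + ∑ o ∈ O ∩ A, (g (insert o V) - g V) =
        ∑ o ∈ O, (g (insert o V) - g V) := by
      rw [add_comm, sum_inter_add_sum_sdiff]
    have hunion := union_le_add_sum_marginal hsub O V
    have of_sum_le (hle : ∑ o ∈ O ∩ A, (g (insert o V) - g V) ≤ M + g V) :
        ∃ T : Finset E → Finset E,
          (∀ S ∈ A.powerset, T S ⊆ V ∪ S) ∧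
          (∀ S ∈ A.powerset, g (T S) ≤ g (densityGreedyAux g c S n V (b - ∑ e ∈ V, c e))) ∧
          ∑ S ∈ A.powerset, g (O ∪ T S) ≤
            ∑ S ∈ A.powerset, (3 * g (T S) + M - g V + Q) :=
      ⟨fun _ => V, fun S _ => subset_union_left,
        fun S _ => le_densityGreedyAux g c S n V _, sum_le_sum fun S _ => by linarith⟩
    by_cases hfit : ∀ o ∈ O ∩ A, c o ≤ b - ∑ e ∈ V, c e
    swap
    · push Not at hfit
      obtain ⟨o, ho, hoC⟩ := hfit
      apply of_sum_le
      rw [← add_sum_erase _ _ ho]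
      have h1 := (marginal_le_singleton hg hsub o V).trans (hM o)
      have h2 : ∑ x ∈ (O ∩ A).erase o, (g (insert x V) - g V) ≤
          ∑ x ∈ (O ∩ A).erase o, l * c x :=
        sum_le_sum fun x hx => by
          have hx' := mem_inter.mp (mem_of_mem_erase hx)
          exact hA x hx'.2 (Or.inr hx'.1)
      rw [← mul_sum] at h2
      have h3 : c o + ∑ x ∈ (O ∩ A).erase o, c x ≤ b := by
        rw [add_sum_erase _ _ ho]
        exact (sum_le_sum_of_subset_of_nonneg inter_subset_left
          fun x _ _ => (hc x).le).trans hO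
      nlinarith
    by_cases hF : (greedyCandidates g c A V (b - ∑ e ∈ V, c e)).Nonempty
    swap
    · apply of_sum_le
      refine (sum_nonpos fun o ho => ?_).trans (add_nonneg hM0 (hg V))
      by_contra! hpos
      refine hF ⟨o, mem_greedyCandidates.mpr
        ⟨(mem_inter.mp ho).2, fun hoV => ?_, hfit o ho, hpos⟩⟩
      rw [insert_eq_of_mem hoV, sub_self] at hpos
      exact hpos.false
    obtain ⟨e, he⟩ : ∃ e, pick (greedyCandidates g c A V (b - ∑ e ∈ V, c e))
        (fun e => (g (insert e V) - g V) / c e) hF = e := ⟨_, rfl⟩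
    obtain ⟨heA, heV, heC, hgain⟩ := mem_greedyCandidates.mp (he ▸ pick_mem _ _ hF)
    obtain ⟨m, rfl⟩ : ∃ m, n = m + 1 := ⟨n - 1, by omega⟩
    set r : ℝ := (g (insert e V) - g V) / c e
    have hr0 : 0 ≤ r := div_nonneg hgain.le (hc e).le
    have hrc : r * c e = g (insert e V) - g V := div_mul_cancel₀ _ (hc e).ne'
    have hrl : r ≤ l := (div_le_iff₀ (hc e)).mpr (hA e heA (Or.inl heC))
    have hVr : (∑ x ∈ V, c x) * r ≤ g V :=
      (mul_le_mul_of_nonneg_left hrl (sum_nonneg fun x _ => (hc x).le)).trans hV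
    have hdens : ∀ a ∈ A, c a ≤ b - ∑ x ∈ V, c x → g (insert a V) - g V ≤ r * c a := by
      intro a ha haC
      rcases le_or_gt (g (insert a V) - g V) 0 with h0 | h0
      · exact h0.trans (mul_nonneg hr0 (hc a).le)
      · have haV : a ∉ V := fun haV => by
          rw [insert_eq_of_mem haV, sub_self] at h0
          exact h0.false
        have h1 := le_pick _ (fun e => (g (insert e V) - g V) / c e) hF
          (mem_greedyCandidates.mpr ⟨ha, haV, haC, h0⟩)
        rw [he] at h1
        exact (div_le_iff₀ (hc a)).mp h1
    have hfits : ∀ a ∈ A, (c a ≤ b - ∑ x ∈ V, c x ∨ a ∈ O) → c a ≤ b - ∑ x ∈ V, c x :=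
      fun a ha h => h.elim id fun haO => hfit a (mem_inter.mpr ⟨haO, ha⟩)
    have hcard : #(A.erase e) = k := by rw [card_erase_of_mem heA, hk]; rfl
    have hcV : ∑ x ∈ insert e V, c x = c e + ∑ x ∈ V, c x := sum_insert heV
    have hQ1 : ∑ o ∈ O \ A.erase e, (g (insert o V) - g V) ≤
        Q + (g (insert e V) - g V) := by
      by_cases heO : e ∈ O
      · rw [sdiff_erase heO, sum_insert (by simp [heA])]
        linarith
      · have : O \ A.erase e = O \ A := by
          ext x
          simp only [mem_sdiff, mem_erase]
          grind
        rw [this]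
        linarith
    have hQ2 : ∑ o ∈ O \ A.erase e,
        (g (insert o (insert e V)) - g (insert e V)) ≤ Q := by
      have h1 : ∑ o ∈ O \ A, (g (insert o (insert e V)) - g (insert e V)) ≤ Q :=
        (sum_le_sum fun o ho => marginal_insert_le hsub (fun h => by
          rw [h] at ho
          exact (mem_sdiff.mp ho).2 heA) V).trans hQ
      by_cases heO : e ∈ O
      · rw [sdiff_erase heO, sum_insert (by simp [heA]), insert_idem, sub_self, zero_add]
        exact h1
      · have : O \ A.erase e = O \ A := by
          ext x
          simp only [mem_sdiff, mem_erase]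
          grind
        rw [this]
        exact h1
    obtain ⟨T₁, hsub₁, hle₁, hsum₁⟩ := ih (m + 1) V (A.erase e) r
      (Q + (g (insert e V) - g V)) hcard (by omega) hr0 hVr
      (fun a ha h => hdens a (mem_of_mem_erase ha) (hfits a (mem_of_mem_erase ha) h)) hQ1
    obtain ⟨T₂, hsub₂, hle₂, hsum₂⟩ := ih m (insert e V) (A.erase e) r Q hcard (by omega) hr0
      (by rw [hcV]; linarith)
      (fun a ha h => (marginal_insert_le hsub (ne_of_mem_erase ha) V).trans <|
        hdens a (mem_of_mem_erase ha) <| hfits a (mem_of_mem_erase ha) <|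
          h.imp_left fun h => by rw [hcV] at h; linarith [hc e]) hQ2
    have hpow : ∀ S ∈ A.powerset, S.erase e ∈ (A.erase e).powerset := fun S hS =>
      mem_powerset.mpr (erase_subset_erase _ (mem_powerset.mp hS))
    refine ⟨fun S => if e ∈ S then T₂ (S.erase e) else T₁ S, ?_, ?_, ?_⟩
    · intro S hS
      dsimp only
      split_ifs with heS
      · refine (hsub₂ _ (hpow S hS)).trans ?_
        rw [insert_union, ← union_insert, insert_erase heS]
      · exact hsub₁ S (by simpa [erase_eq_of_notMem heS] using hpow S hS)
    · intro S hS
      dsimp only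
      split_ifs with heS
      · refine (hle₂ _ (hpow S hS)).trans (le_of_eq ?_)
        have h1 := densityGreedyAux_insert_pick g c m V _ hF he
          ((erase_subset e S).trans (mem_powerset.mp hS))
        rw [insert_erase heS] at h1
        rw [h1, hcV]
        congr 2
        ring
      · exact hle₁ S (by simpa [erase_eq_of_notMem heS] using hpow S hS)
    · have hsplitA : ∀ f : Finset E → ℝ, ∑ S ∈ A.powerset, f S =
          ∑ S ∈ (A.erase e).powerset, f S + ∑ S ∈ (A.erase e).powerset, f (insert e S) := by
        intro f
        conv_lhs => rw [← insert_erase heA]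
        exact sum_powerset_insert (notMem_erase e A) f
      rw [hsplitA, hsplitA, ← sum_add_distrib, ← sum_add_distrib]
      have hno : ∀ S ∈ (A.erase e).powerset, e ∉ S := fun S hS h =>
        notMem_erase e A (mem_powerset.mp hS h)
      calc _ = ∑ S ∈ (A.erase e).powerset, (g (O ∪ T₁ S) + g (O ∪ T₂ S)) :=
            sum_congr rfl fun S hS => by
              simp [hno S hS, erase_insert (hno S hS)]
        _ ≤ ∑ S ∈ (A.erase e).powerset,
              (3 * g (T₁ S) + M - g V + (Q + (g (insert e V) - g V))) +
            ∑ S ∈ (A.erase e).powerset, (3 * g (T₂ S) + M - g (insert e V) + Q) := by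
            rw [sum_add_distrib]
            exact add_le_add hsum₁ hsum₂
        _ = _ := by
            rw [← sum_add_distrib]
            refine sum_congr rfl fun S hS => ?_
            simp only [hno S hS, erase_insert (hno S hS), mem_insert_self, if_true, if_false]
            ring

end Greedy

/-- Every element lies in exactly half of the subsets. -/
theorem two_mul_card_filter_mem [Fintype E] [DecidableEq E] (e : E) :
    2 * #{S : Finset E | e ∈ S} = 2 ^ Fintype.card E := by
  have h : #{S : Finset E | e ∈ S} = #{S : Finset E | e ∉ S} := by
    refine card_bij' (fun S _ => S.erase e) (fun S _ => insert e S) ?_ ?_ ?_ ?_ <;>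
      simp +contextual [insert_erase]
  have h2 := card_filter_add_card_filter_not (s := (univ : Finset (Finset E))) (fun S => e ∈ S)
  rw [card_univ, Fintype.card_finset] at h2
  omega

theorem deterministic_knapsack_one_tenth
    [Fintype E] [DecidableEq E] [Nonempty E] [LinearOrder E]
    (g : Finset E → ℝ) (c : E → ℝ) (b : ℝ)
    (hg : ∀ S : Finset E, 0 ≤ g S)
    (hsub : ∀ S T : Finset E, g (S ∪ T) + g (S ∩ T) ≤ g S + g T)
    (hc : ∀ e : E, 0 < c e) (hb : 0 < b) :
    (1 / 5) * (Finset.univ.sup' Finset.univ_nonempty fun e : E => g {e}) +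
      (4 / 5) * (((2 : ℝ) ^ Fintype.card E)⁻¹ * ∑ S : Finset E, g (densityGreedy g c b S)) ≥
      (1 / 10) *
        ((Finset.univ.powerset.filter fun T : Finset E => ∑ e ∈ T, c e ≤ b).sup'
          ⟨∅, Finset.mem_filter.mpr ⟨Finset.empty_mem_powerset _, by simp [hb.le]⟩⟩ g) := by

  set M := Finset.univ.sup' Finset.univ_nonempty fun e : E => g {e}
  have hM : ∀ e, g {e} ≤ M := fun e => le_sup' (fun e : E => g {e}) (mem_univ e)
  have hM0 : 0 ≤ M := (hg _).trans (hM (Classical.arbitrary E))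
  obtain ⟨O, hOmem, hOeq⟩ := exists_mem_eq_sup'
    (s := Finset.univ.powerset.filter fun T : Finset E => ∑ e ∈ T, c e ≤ b)
    ⟨∅, Finset.mem_filter.mpr ⟨Finset.empty_mem_powerset _, by simp [hb.le]⟩⟩ g
  rw [hOeq]
  have hO : ∑ e ∈ O, c e ≤ b := (mem_filter.mp hOmem).2
  obtain ⟨l, hl⟩ := (Set.finite_range fun a : E => (g (insert a ∅) - g ∅) / c a).bddAbove
  obtain ⟨T, hTsub, hTle, hTsum⟩ := exists_stopped_greedy hg hsub hc hM hM0 hO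
    (Fintype.card E) (Fintype.card E) ∅ univ (max l 0) 0 card_univ le_rfl (le_max_right _ _)
    (by simpa using hg ∅)
    (fun a _ _ => (div_le_iff₀ (hc a)).mp ((hl ⟨a, rfl⟩).trans (le_max_left _ _)))
    (by rw [sdiff_eq_empty_iff_subset.mpr (subset_univ O), sum_empty])
  rw [powerset_univ] at hTsub hTle hTsum
  set N : ℝ := (2 : ℝ) ^ Fintype.card E with hN
  have hNpos : 0 < N := by positivity
  have hcardN : (#(univ : Finset (Finset E)) : ℝ) = N := by
    rw [card_univ, Fintype.card_finset]
    push_cast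
    rfl
  have hlow := le_sum_of_card_mem_le (h := fun X => g (O ∪ X)) (fun X => hg _)
    (fun X Y => by
      rw [union_union_distrib_left, union_inter_distrib_left]
      exact hsub _ _)
    univ (N / 2) univ T 0 (by positivity) (fun S _ => subset_univ _)
    (fun e _ => by positivity)
    (fun e _ => by
      have h1 : #{S : Finset E | e ∈ T S} ≤ #{S : Finset E | e ∈ S} :=
        card_le_card fun S hS => by
          simp only [mem_filter, mem_univ, true_and] at hS ⊢
          simpa using hTsub S (mem_univ S) hS
      have h2 : (2 : ℝ) * #{S : Finset E | e ∈ S} = N := by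
        rw [hN]
        exact_mod_cast two_mul_card_filter_mem e
      have h3 : (#{S : Finset E | e ∈ T S} : ℝ) ≤ #{S : Finset E | e ∈ S} := by
        exact_mod_cast h1
      linarith)
  rw [hcardN, union_empty, zero_mul, add_zero] at hlow
  have hup : ∑ S : Finset E, (3 * g (T S) + M - g ∅ + 0) ≤
      ∑ S : Finset E, (3 * g (densityGreedy g c b S) + M) :=
    sum_le_sum fun S _ => by
      have h := hTle S (mem_univ S)
      rw [sum_empty, sub_zero] at h
      change g (T S) ≤ g (densityGreedy g c b S) at h
      linarith [hg ∅]
  replace hup := hTsum.trans hup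
  rw [sum_add_distrib, ← mul_sum, sum_const, nsmul_eq_mul, hcardN] at hup
  set X := ∑ S : Finset E, g (densityGreedy g c b S)
  have hX0 : 0 ≤ N⁻¹ * X := mul_nonneg (inv_nonneg.mpr hNpos.le) (sum_nonneg fun S _ => hg _)
  have hNX : N * (N⁻¹ * X) = X := mul_inv_cancel_left₀ hNpos.ne' X
  have hmain : N * (g O / 2) ≤ N * (3 * (N⁻¹ * X) + M) := by linarith
  have := le_of_mul_le_mul_left hmain hNpos
  linarith
end
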